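/- Let f : ℤ → ℝ be nonnegative with bounded variation, fix a system of peaks as in the context, and suppose the class E^n_k is nonempty for some n ≥ 6 and k ∈ ℤ. Then at least one of the following holds. (A) There exist integers s < α < β < γ < δ < t with (k−64)·2^{n−5} ≤ s, t ≤ (k+65)·2^{n−5}, α−s ≥ 2^{n−5}, β−α ≥ 2^{n−5}, γ−β ≥ 2^{n−4}, δ−γ ≥ 2^{n−5}, t−δ ≥ 2^{n−5}, and min{f(s), f(t)} − max{A_{α,β}f, A_{γ,δ}f} ≥ (1/24)·Var E^n_k. (B) There exist integers α < β < u < v < γ < δ with (k−64)·2^{n−5} ≤ α, δ ≤ (k+65)·2^{n−5}, β−α ≥ 2^{n−5}, u−β ≥ 2^{n−5}, v−u ≥ 2^{n−5}, γ−v ≥ 2^{n−5}, δ−γ ≥ 2^{n−5}, and min{A_{α,β}f, A_{γ,δ}f} − A_{u,v}f ≥ (1/24)·Var E^n_k. -/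

import Mathlib

open Finset

noncomputable section

/-- Average of `f : ℤ → ℝ` over the integer interval `[x, y]`:
`A_{x,y} f = (1/(y-x+1)) ∑_{k=x}^{y} f(k)`. -/
def avg (f : ℤ → ℝ) (x y : ℤ) : ℝ :=
  (∑ k ∈ Finset.Icc x y, f k) / ((y - x + 1 : ℤ) : ℝ)

/-- The discrete centered Hardy–Littlewood maximal function
`Mf(n) = sup_{r ≥ 0} (1/(2r+1)) ∑_{k=-r}^{r} |f(n+k)|`. -/
def dM (f : ℤ → ℝ) (n : ℤ) : ℝ :=
  ⨆ r : ℕ, avg (fun k => |f k|) (n - r) (n + r)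

/-- The total variation `Var f = ∑_{k ∈ ℤ} |f(k+1) - f(k)|`. -/
def dVar (f : ℤ → ℝ) : ℝ := ∑' k : ℤ, |f (k + 1) - f k|

/-- `f` has bounded variation. -/
def BddVar (f : ℤ → ℝ) : Prop := Summable fun k : ℤ => |f (k + 1) - f k|

/-- A peak for `f`: integers `p < r < q` with `Mf(p) < Mf(r)` and `Mf(q) < Mf(r)`. -/
def IsPeak (f : ℤ → ℝ) (p r q : ℤ) : Prop :=
  p < r ∧ r < q ∧ dM f p < dM f r ∧ dM f q < dM f r

/-- The variation of a peak `{p < r < q}`: `2·Mf(r) - Mf(p) - Mf(q)`. -/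
def peakVar (f : ℤ → ℝ) (p r q : ℤ) : ℝ := 2 * dM f r - dM f p - dM f q

/-- An essential peak: `max_{p<k<q} f(k) ≤ Mf(r) - (1/4)·Var{p,r,q}`. -/
def IsEssentialPeak (f : ℤ → ℝ) (p r q : ℤ) : Prop :=
  IsPeak f p r q ∧
    ∀ k : ℤ, p < k → k < q → f k ≤ dM f r - (1 / 4) * peakVar f p r q

/-- `w` is the radius `ω(r)` of an (essential) peak with center `r`:
the largest integer `w > 0` with `A_w f(r) = Mf(r)`. -/
def IsRadius (f : ℤ → ℝ) (r w : ℤ) : Prop :=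
  0 < w ∧ avg f (r - w) (r + w) = dM f r ∧
    ∀ w' : ℤ, 0 < w' → avg f (r - w') (r + w') = dM f r → w' ≤ w

open scoped Classical

/-- The class `E^n_k` of (indices of) essential peaks `𝕡_i = {a_i < b_i < a_{i+1}}`
of the fixed system with radius `2^{n-1} < ω(b_i) ≤ 2^n` and
`k·2^{n-5} < b_i ≤ (k+1)·2^{n-5}`. -/
def Enk (f : ℤ → ℝ) (a b : ℕ → ℤ) (σ n : ℕ) (k : ℤ) : Finset ℕ :=
  (Finset.Icc 1 σ).filter fun i =>
    IsEssentialPeak f (a i) (b i) (a (i + 1)) ∧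
    ∃ w : ℤ, IsRadius f (b i) w ∧ 2 ^ (n - 1) < w ∧ w ≤ 2 ^ n ∧
      k * 2 ^ (n - 5) < b i ∧ b i ≤ (k + 1) * 2 ^ (n - 5)

/-- `Var E^n_k`, the total variation of the peaks in the class `E^n_k`. -/
def varEnk (f : ℤ → ℝ) (a b : ℕ → ℤ) (σ n : ℕ) (k : ℤ) : ℝ :=
  ∑ i ∈ Enk f a b σ n k, peakVar f (a i) (b i) (a (i + 1))

/-- Alternative A of Lemma 5, for the class indexed by `(n,k)`, with `V = Var E^n_k`. -/
def AltA (f : ℤ → ℝ) (n : ℕ) (k : ℤ) (V : ℝ) : Prop :=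
  ∃ s α β γ δ t : ℤ, s < α ∧ α < β ∧ β < γ ∧ γ < δ ∧ δ < t ∧
    (k - 64) * 2 ^ (n - 5) ≤ s ∧ t ≤ (k + 65) * 2 ^ (n - 5) ∧
    2 ^ (n - 5) ≤ α - s ∧ 2 ^ (n - 5) ≤ β - α ∧ 2 ^ (n - 4) ≤ γ - β ∧
    2 ^ (n - 5) ≤ δ - γ ∧ 2 ^ (n - 5) ≤ t - δ ∧
    (1 / 24 : ℝ) * V ≤ min (f s) (f t) - max (avg f α β) (avg f γ δ)

/-- Alternative B of Lemma 5, for the class indexed by `(n,k)`, with `V = Var E^n_k`. -/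
def AltB (f : ℤ → ℝ) (n : ℕ) (k : ℤ) (V : ℝ) : Prop :=
  ∃ α β u v γ δ : ℤ, α < β ∧ β < u ∧ u < v ∧ v < γ ∧ γ < δ ∧
    (k - 64) * 2 ^ (n - 5) ≤ α ∧ δ ≤ (k + 65) * 2 ^ (n - 5) ∧
    2 ^ (n - 5) ≤ β - α ∧ 2 ^ (n - 5) ≤ u - β ∧ 2 ^ (n - 5) ≤ v - u ∧
    2 ^ (n - 5) ≤ γ - v ∧ 2 ^ (n - 5) ≤ δ - γ ∧
    (1 / 24 : ℝ) * V ≤ min (avg f α β) (avg f γ δ) - avg f u v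

theorem bddVar_bound (f : ℤ → ℝ) (hbv : BddVar f) : ∃ C, ∀ n, |f n| ≤ C := by
  refine ⟨|f 0| + ∑' k : ℤ, |f (k + 1) - f k|, fun n => ?_⟩
  have key : ∀ (m : ℕ) (x : ℤ), |f (x + m) - f x| ≤ ∑ k ∈ Finset.Ico x (x + m), |f (k + 1) - f k| := by
    intro m
    induction m with
    | zero => intro x; simp
    | succ m ih =>
      intro x
      have h1 : Finset.Ico x (x + ((m + 1 : ℕ) : ℤ)) = insert (x + m) (Finset.Ico x (x + m)) := by
        ext y; simp only [Finset.mem_Ico, Finset.mem_insert]; push_cast; omega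
      rw [h1, Finset.sum_insert (by simp)]
      have h2 : x + ((m + 1 : ℕ) : ℤ) = x + m + 1 := by push_cast; ring
      rw [h2]
      have := abs_sub_le (f (x + m + 1)) (f (x + m)) (f x)
      linarith [ih x]
  have key2 : ∀ (m : ℕ) (x : ℤ), |f (x + m) - f x| ≤ ∑' k : ℤ, |f (k + 1) - f k| := fun m x =>
    (key m x).trans (hbv.sum_le_tsum _ (fun _ _ => abs_nonneg _))
  rcases le_total 0 n with h | h
  · have h3 := key2 n.toNat 0
    rw [Int.toNat_of_nonneg h, zero_add] at h3
    have := abs_sub_abs_le_abs_sub (f n) (f 0)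
    linarith
  · have h3 := key2 (-n).toNat n
    rw [Int.toNat_of_nonneg (by omega), add_neg_cancel] at h3
    have := abs_sub_abs_le_abs_sub (f n) (f 0)
    rw [abs_sub_comm] at h3
    linarith

theorem sum_eq_avg (f : ℤ → ℝ) (x y : ℤ) (h : x ≤ y) :
    ∑ k ∈ Finset.Icc x y, f k = avg f x y * ((y - x + 1 : ℤ) : ℝ) := by
  unfold avg
  have : ((y - x + 1 : ℤ) : ℝ) ≠ 0 := by
    have : y - x + 1 ≠ 0 := by omega
    exact_mod_cast this
  field_simp

theorem avg_le_of (f : ℤ → ℝ) (x y : ℤ) (c : ℝ) (h : x ≤ y)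
    (hc : ∀ k, x ≤ k → k ≤ y → f k ≤ c) : avg f x y ≤ c := by
  have hpos : (0 : ℝ) < ((y - x + 1 : ℤ) : ℝ) := by
    have : 0 < y - x + 1 := by omega
    exact_mod_cast this
  unfold avg
  rw [div_le_iff₀ hpos]
  have h1 := Finset.sum_le_card_nsmul (Finset.Icc x y) f c (fun k hk => by
    rw [Finset.mem_Icc] at hk; exact hc k hk.1 hk.2)
  rw [Int.card_Icc, nsmul_eq_mul] at h1
  have h2 : (((y + 1 - x).toNat : ℕ) : ℝ) = ((y - x + 1 : ℤ) : ℝ) := by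
    have : (((y + 1 - x).toNat : ℕ) : ℤ) = y - x + 1 := by omega
    exact_mod_cast this
  rw [h2] at h1
  linarith

theorem exists_ge_sum (f : ℤ → ℝ) (x y : ℤ) (c : ℝ) (h : x ≤ y)
    (hc : c * ((y - x + 1 : ℤ) : ℝ) ≤ ∑ k ∈ Finset.Icc x y, f k) :
    ∃ k, x ≤ k ∧ k ≤ y ∧ c ≤ f k := by
  have h2 : (((y + 1 - x).toNat : ℕ) : ℝ) = ((y - x + 1 : ℤ) : ℝ) := by
    have : (((y + 1 - x).toNat : ℕ) : ℤ) = y - x + 1 := by omega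
    exact_mod_cast this
  obtain ⟨k, hk, hk2⟩ := Finset.exists_le_of_sum_le (s := Finset.Icc x y) (f := fun _ => c) (g := f)
    (by simpa using h) (by
      rw [Finset.sum_const, Int.card_Icc, nsmul_eq_mul, h2]; linarith)
  rw [Finset.mem_Icc] at hk
  exact ⟨k, hk.1, hk.2, hk2⟩

theorem avg_le_dM (f : ℤ → ℝ) (hf : ∀ n, 0 ≤ f n) (hbv : BddVar f) (x w : ℤ) (hw : 0 ≤ w) :
    avg f (x - w) (x + w) ≤ dM f x := by
  obtain ⟨C, hC⟩ := bddVar_bound f hbv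
  have habs : (fun k => |f k|) = f := funext fun k => abs_of_nonneg (hf k)
  have hb : BddAbove (Set.range fun r : ℕ => avg (fun k => |f k|) (x - r) (x + r)) := by
    refine ⟨C, ?_⟩
    rintro _ ⟨r, rfl⟩
    exact avg_le_of _ _ _ _ (by omega) (fun k _ _ => hC k)
  have := le_ciSup hb w.toNat
  simp only [habs] at this
  unfold dM
  simp only [habs]
  rwa [Int.toNat_of_nonneg hw] at this

theorem le_dM (f : ℤ → ℝ) (hf : ∀ n, 0 ≤ f n) (hbv : BddVar f) (x : ℤ) : f x ≤ dM f x := by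
  have := avg_le_dM f hf hbv x 0 le_rfl
  simpa [avg] using this

theorem sum_split (f : ℤ → ℝ) (x y z : ℤ) (h1 : x ≤ y) (h2 : y ≤ z) :
    ∑ k ∈ Finset.Icc x z, f k
      = ∑ k ∈ Finset.Icc x y, f k + ∑ k ∈ Finset.Icc (y + 1) z, f k := by
  rw [← Finset.sum_union]
  · congr 1
    ext k; simp only [Finset.mem_Icc, Finset.mem_union]; omega
  · rw [Finset.disjoint_left]; intro k; simp only [Finset.mem_Icc]; omega

/-- high point to the right -/
theorem right_point (f : ℤ → ℝ) (hf : ∀ n, 0 ≤ f n) (hbv : BddVar f) (r w d : ℤ)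
    (hd : 0 < d) (hdw : d ≤ w) (hr : avg f (r - w) (r + w) = dM f r) (κ : ℝ)
    (hκ : κ * d ≤ dM f r - dM f (r - d)) (hκ0 : 0 ≤ κ) :
    ∃ t, r + w - 2 * d + 1 ≤ t ∧ t ≤ r + w ∧ dM f r + κ * (w - d) ≤ f t := by
  apply exists_ge_sum f _ _ _ (by omega)
  have h0 := sum_eq_avg f (r - w) (r + w) (by omega)
  rw [hr, sum_split f (r - w) (r + w - 2 * d) (r + w) (by omega) (by omega)] at h0
  have h1 := sum_eq_avg f (r - w) (r + w - 2 * d) (by omega)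
  have h2 := avg_le_dM f hf hbv (r - d) (w - d) (by omega)
  rw [show r - d - (w - d) = r - w by ring, show r - d + (w - d) = r + w - 2 * d by ring] at h2
  have hdw' : (d : ℝ) ≤ w := by exact_mod_cast hdw
  have hd' : (0 : ℝ) < d := by exact_mod_cast hd
  have h3 : avg f (r - w) (r + w - 2 * d) * (2 * (w - d) + 1 : ℝ)
      ≤ dM f (r - d) * (2 * (w - d) + 1) :=
    mul_le_mul_of_nonneg_right h2 (by linarith)
  have h4 : κ * d * (2 * (w - d) + 1 : ℝ) ≤ (dM f r - dM f (r - d)) * (2 * (w - d) + 1) :=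
    mul_le_mul_of_nonneg_right hκ (by linarith)
  push_cast at h0 h1 ⊢
  have h5 : 0 ≤ κ * d := by positivity
  nlinarith

theorem left_point (f : ℤ → ℝ) (hf : ∀ n, 0 ≤ f n) (hbv : BddVar f) (r w d : ℤ)
    (hd : 0 < d) (hdw : d ≤ w) (hr : avg f (r - w) (r + w) = dM f r) (κ : ℝ)
    (hκ : κ * d ≤ dM f r - dM f (r + d)) (hκ0 : 0 ≤ κ) :
    ∃ t, r - w ≤ t ∧ t ≤ r - w + 2 * d - 1 ∧ dM f r + κ * (w - d) ≤ f t := by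
  apply exists_ge_sum f _ _ _ (by omega)
  have h0 := sum_eq_avg f (r - w) (r + w) (by omega)
  rw [hr, sum_split f (r - w) (r - w + 2 * d - 1) (r + w) (by omega) (by omega)] at h0
  rw [show r - w + 2 * d - 1 + 1 = r - w + 2 * d by ring] at h0
  have h1 := sum_eq_avg f (r - w + 2 * d) (r + w) (by omega)
  have h2 := avg_le_dM f hf hbv (r + d) (w - d) (by omega)
  rw [show r + d - (w - d) = r - w + 2 * d by ring, show r + d + (w - d) = r + w by ring] at h2
  have hdw' : (d : ℝ) ≤ w := by exact_mod_cast hdw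
  have hd' : (0 : ℝ) < d := by exact_mod_cast hd
  have h3 : avg f (r - w + 2 * d) (r + w) * (2 * (w - d) + 1 : ℝ)
      ≤ dM f (r + d) * (2 * (w - d) + 1) :=
    mul_le_mul_of_nonneg_right h2 (by linarith)
  have h4 : κ * d * (2 * (w - d) + 1 : ℝ) ≤ (dM f r - dM f (r + d)) * (2 * (w - d) + 1) :=
    mul_le_mul_of_nonneg_right hκ (by linarith)
  push_cast at h0 h1 ⊢
  have h5 : 0 ≤ κ * d := by positivity
  nlinarith

def CoreA (f : ℤ → ℝ) (L lo hi : ℤ) (θ : ℝ) : Prop :=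
  ∃ s α β γ δ t : ℤ, lo ≤ s ∧ t ≤ hi ∧
    L ≤ α - s ∧ L ≤ β - α ∧ 2 * L ≤ γ - β ∧ L ≤ δ - γ ∧ L ≤ t - δ ∧
    θ ≤ min (f s) (f t) - max (avg f α β) (avg f γ δ)

def CoreB (f : ℤ → ℝ) (L lo hi : ℤ) (θ : ℝ) : Prop :=
  ∃ α β u v γ δ : ℤ, lo ≤ α ∧ δ ≤ hi ∧
    L ≤ β - α ∧ L ≤ u - β ∧ L ≤ v - u ∧ L ≤ γ - v ∧ L ≤ δ - γ ∧
    θ ≤ min (avg f α β) (avg f γ δ) - avg f u v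

theorem coreA_of (f : ℤ → ℝ) (L lo hi : ℤ) (θ H : ℝ) (s α β γ δ t : ℤ) (h1 : lo ≤ s) (h2 : t ≤ hi)
    (h3 : L ≤ α - s) (h4 : L ≤ β - α) (h5 : 2 * L ≤ γ - β) (h6 : L ≤ δ - γ) (h7 : L ≤ t - δ)
    (hs : H ≤ f s) (ht : H ≤ f t) (ha : avg f α β ≤ H - θ) (hb : avg f γ δ ≤ H - θ) :
    CoreA f L lo hi θ :=
  ⟨s, α, β, γ, δ, t, h1, h2, h3, h4, h5, h6, h7, by
    have := le_min hs ht
    have := max_le ha hb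
    linarith⟩

theorem core (f : ℤ → ℝ) (l lo hi p s t : ℤ) (hl : 0 < l) (θ P : ℝ) (hθ : 0 < θ)
    (hs : s + 9 * l + 3 ≤ p) (ht : p + 9 * l + 3 ≤ t) (hlo : lo ≤ s) (hhi : t ≤ hi)
    (hfs : P + 2 * θ ≤ f s) (hft : P + 2 * θ ≤ f t)
    (hP : avg f (p - l) (p + l) ≤ P) :
    CoreA f (2 * l) lo hi θ ∨ CoreB f (2 * l) lo hi θ := by
  by_cases h1 : avg f (p - 7 * l - 3) (p - 5 * l - 3) ≤ P + θ
  · left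
    exact coreA_of f _ lo hi θ (P + 2 * θ) s (p - 7 * l - 3) (p - 5 * l - 3) (p - l) (p + l) t hlo hhi (by omega) (by omega) (by omega)
      (by omega) (by omega) hfs hft (by linarith) (by linarith : avg f (p - l) (p + l) ≤ _)
  by_cases h2 : avg f (p + 5 * l + 3) (p + 7 * l + 3) ≤ P + θ
  · left
    exact coreA_of f _ lo hi θ (P + 2 * θ) s (p - l) (p + l) (p + 5 * l + 3) (p + 7 * l + 3) t hlo hhi (by omega) (by omega) (by omega)
      (by omega) (by omega) hfs hft (by linarith : avg f (p - l) (p + l) ≤ _) (by linarith)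
  · right
    push Not at h1 h2
    refine ⟨p - 7 * l - 3, p - 5 * l - 3, p - l, p + l, p + 5 * l + 3, p + 7 * l + 3,
      by omega, by omega, by omega, by omega, by omega, by omega, by omega, ?_⟩
    have := le_min h1.le h2.le
    linarith

theorem single (f : ℤ → ℝ) (hf : ∀ n, 0 ≤ f n) (hbv : BddVar f) (l p r q w : ℤ) (hl : 0 < l)
    (θ : ℝ) (hθ : 0 < θ) (hE : IsEssentialPeak f p r q)
    (hr : avg f (r - w) (r + w) = dM f r) (hw : 32 * l < w)
    (hV : 4 * θ ≤ peakVar f p r q) :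
    CoreA f (2 * l) (r - w) (r + w) θ ∨ CoreB f (2 * l) (r - w) (r + w) θ := by
  obtain ⟨⟨hpr, hrq, hp, hq⟩, hess⟩ := hE
  have hlt : ∀ x, p ≤ x → x ≤ q → f x < dM f r := by
    intro x hx1 hx2
    rcases hx1.eq_or_lt with rfl | hx1
    · exact (le_dM f hf hbv _).trans_lt hp
    rcases hx2.eq_or_lt with rfl | hx2
    · exact (le_dM f hf hbv _).trans_lt hq
    have := hess x hx1 hx2
    linarith
  have hR : r - p ≤ w → ∃ t, r + w - 2 * (r - p) + 1 ≤ t ∧ t ≤ r + w ∧ dM f r ≤ f t := by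
    intro h
    have := right_point f hf hbv r w (r - p) (by omega) h hr 0 (by
      rw [show r - (r - p) = p by ring]; linarith) le_rfl
    simpa using this
  have hL : q - r ≤ w → ∃ t, r - w ≤ t ∧ t ≤ r - w + 2 * (q - r) - 1 ∧ dM f r ≤ f t := by
    intro h
    have := left_point f hf hbv r w (q - r) (by omega) h hr 0 (by
      rw [show r + (q - r) = q by ring]; linarith) le_rfl
    simpa using this
  have hbig : ¬ (w ≤ r - p ∧ w ≤ q - r) := by
    rintro ⟨h1, h2⟩
    obtain ⟨x, hx1, hx2, hx3⟩ := exists_ge_sum f (r - w) (r + w) (dM f r) (by omega)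
      (by rw [sum_eq_avg f _ _ (by omega), hr])
    exact absurd (hlt x (by omega) (by omega)) (not_lt.mpr hx3)
  have hd : r - p < w := by
    by_contra h
    obtain ⟨x, hx1, hx2, hx3⟩ := hL (by omega)
    exact absurd (hlt x (by omega) (by omega)) (not_lt.mpr hx3)
  have he : q - r < w := by
    by_contra h
    obtain ⟨x, hx1, hx2, hx3⟩ := hR (by omega)
    exact absurd (hlt x (by omega) (by omega)) (not_lt.mpr hx3)
  obtain ⟨t, ht1, ht2, ht3⟩ := hR hd.le
  obtain ⟨s, hs1, hs2, hs3⟩ := hL he.le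
  have hsp : s < p := by
    by_contra h
    exact absurd (hlt s (by omega) (by omega)) (not_lt.mpr hs3)
  have htq : q < t := by
    by_contra h
    exact absurd (hlt t (by omega) (by omega)) (not_lt.mpr ht3)
  have hlow : ∀ x y, p < x → x ≤ y → y < q → avg f x y ≤ dM f r - θ := by
    intro x y h1 h2 h3
    apply avg_le_of f _ _ _ h2
    intro k hk1 hk2
    have := hess k (by omega) (by omega)
    linarith
  by_cases c1 : 12 * l ≤ q - p
  · left
    exact coreA_of f _ _ _ θ (dM f r) s (p + 2 * l) (p + 4 * l) (q - 4 * l) (q - 2 * l) t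
      hs1 ht2 (by omega) (by omega) (by omega) (by omega) (by omega) hs3 ht3
      (hlow _ _ (by omega) (by omega) (by omega)) (hlow _ _ (by omega) (by omega) (by omega))
  by_cases c2 : 8 * l + 2 ≤ q - p
  · left
    exact coreA_of f _ _ _ θ (dM f r) s (p + 1) (p + 1 + 2 * l) (q - 1 - 2 * l) (q - 1) t
      hs1 ht2 (by omega) (by omega) (by omega) (by omega) (by omega) hs3 ht3
      (hlow _ _ (by omega) (by omega) (by omega)) (hlow _ _ (by omega) (by omega) (by omega))
  unfold peakVar at hV
  by_cases c3 : dM f p + 2 * θ ≤ dM f r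
  · exact core f l _ _ p s t hl θ (dM f p) hθ (by omega) (by omega) hs1 ht2 (by linarith)
      (by linarith) (avg_le_dM f hf hbv p l hl.le)
  · exact core f l _ _ q s t hl θ (dM f q) hθ (by omega) (by omega) hs1 ht2 (by linarith)
      (by linarith) (avg_le_dM f hf hbv q l hl.le)

theorem tele (I : Finset ℕ) (u v x y : ℕ → ℝ) (κ : ℝ) (hκ : 0 ≤ κ)
    (hxy : ∀ i ∈ I, x i ≤ y i) (hI : I.Nonempty)
    (h : ∀ i ∈ I, ∀ j ∈ I, i < j → u i - v j ≤ κ * (x j - y i)) :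
    ∃ i ∈ I, ∃ j ∈ I, (∀ k ∈ I, k ≤ j) ∧
      ∑ k ∈ I, (u k - v k) ≤ u j - v i + κ * (y j - x i) := by
  induction I using Finset.induction_on_max with
  | empty => exact absurd hI (by simp)
  | insert m s hm ih =>
    have hms : m ∉ s := fun h' => lt_irrefl _ (hm m h')
    rw [Finset.sum_insert hms]
    rcases s.eq_empty_or_nonempty with rfl | hs
    · refine ⟨m, by simp, m, by simp, by simp, ?_⟩
      have := mul_nonneg hκ (sub_nonneg.mpr (hxy m (by simp)))
      simp; linarith
    · obtain ⟨i, hi, j, hj, hmax, hsum⟩ := ih (fun i hi => hxy i (Finset.mem_insert_of_mem hi)) hs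
        (fun i hi j hj => h i (Finset.mem_insert_of_mem hi) j (Finset.mem_insert_of_mem hj))
      refine ⟨i, Finset.mem_insert_of_mem hi, m, Finset.mem_insert_self _ _, ?_, ?_⟩
      · intro k hk
        rcases Finset.mem_insert.mp hk with rfl | hk
        · exact le_rfl
        · exact (hm k hk).le
      · have h1 := h j (Finset.mem_insert_of_mem hj) m (Finset.mem_insert_self _ _) (hm j hj)
        have h2 := mul_nonneg hκ (sub_nonneg.mpr (hxy m (by simp)))
        nlinarith

/-- Some pair has steep slope. -/
theorem steep (I : Finset ℕ) (u v x y : ℕ → ℝ) (Λ θ : ℝ) (hΛ : 0 < Λ) (hθ : 0 < θ)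
    (hxy : ∀ i ∈ I, x i ≤ y i) (hI : I.Nonempty)
    (hord : ∀ i ∈ I, ∀ j ∈ I, i < j → y i ≤ x j)
    (hlen : ∀ i ∈ I, ∀ j ∈ I, y j - x i ≤ Λ)
    (hosc : ∀ i ∈ I, ∀ j ∈ I, u j - v i < 2 * θ)
    (hsum : 8 * θ ≤ ∑ k ∈ I, (u k - v k)) :
    (∃ i ∈ I, θ / Λ * (y i - x i) ≤ u i - v i) ∧
    (∃ i ∈ I, ∃ j ∈ I, i < j ∧ θ / Λ * (x j - y i) ≤ u i - v j) := by
  have hκ : 0 ≤ θ / Λ := by positivity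
  have hb : ∀ i ∈ I, ∀ j ∈ I, θ / Λ * (y j - x i) ≤ θ := by
    intro i hi j hj
    have := mul_le_mul_of_nonneg_left (hlen i hi j hj) hκ
    rwa [div_mul_cancel₀ _ hΛ.ne'] at this
  constructor
  · by_contra! hcon
    obtain ⟨i, hi, j, hj, -, h1⟩ := tele I y x x y 0 le_rfl hxy hI (by
      intro i hi j hj hij; have := hord i hi j hj hij; linarith)
    have h2 : ∑ k ∈ I, (u k - v k) ≤ ∑ k ∈ I, θ / Λ * (y k - x k) :=
      Finset.sum_le_sum fun k hk => (hcon k hk).le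
    rw [← Finset.mul_sum] at h2
    have h3 := mul_le_mul_of_nonneg_left h1 hκ
    have := hb i hi j hj
    linarith
  · by_contra! hcon
    obtain ⟨i, hi, j, hj, -, h1⟩ := tele I u v x y (θ / Λ) hκ hxy hI (by
      intro i hi j hj hij; exact (hcon i hi j hj hij).le)
    have := hb i hi j hj
    have := hosc i hi j hj
    linarith

theorem mainCore (f : ℤ → ℝ) (hf : ∀ n, 0 ≤ f n) (hbv : BddVar f) (l K : ℤ) (hl : 0 < l)
    (E : Finset ℕ) (p r q w : ℕ → ℤ) (hE : E.Nonempty)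
    (hess : ∀ i ∈ E, IsEssentialPeak f (p i) (r i) (q i))
    (hrad : ∀ i ∈ E, avg f (r i - w i) (r i + w i) = dM f (r i))
    (hw : ∀ i ∈ E, 32 * l < w i ∧ w i ≤ 64 * l)
    (hr : ∀ i ∈ E, K < r i ∧ r i ≤ K + 2 * l)
    (hord : ∀ i ∈ E, ∀ j ∈ E, i < j → q i ≤ p j)
    (θ : ℝ) (hV : ∑ i ∈ E, peakVar f (p i) (r i) (q i) = 24 * θ) :
    CoreA f (2 * l) (K - 128 * l) (K + 130 * l) θ ∨
      CoreB f (2 * l) (K - 128 * l) (K + 130 * l) θ := by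
  have hvpos : ∀ i ∈ E, 0 < peakVar f (p i) (r i) (q i) := by
    intro i hi
    obtain ⟨⟨-, -, h1, h2⟩, -⟩ := hess i hi
    unfold peakVar; linarith
  have hθ : 0 < θ := by
    have := Finset.sum_pos hvpos hE
    linarith
  by_cases hbig : ∃ i ∈ E, 4 * θ ≤ peakVar f (p i) (r i) (q i)
  · obtain ⟨i, hi, h4⟩ := hbig
    have hw' := hw i hi
    have hr' := hr i hi
    rcases single f hf hbv l _ _ _ (w i) hl θ hθ (hess i hi) (hrad i hi) hw'.1 h4 with h | h
    · left
      obtain ⟨s, α, β, γ, δ, t, h1, h2, h3⟩ := h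
      exact ⟨s, α, β, γ, δ, t, by omega, by omega, h3⟩
    · right
      obtain ⟨s, α, β, γ, δ, t, h1, h2, h3⟩ := h
      exact ⟨s, α, β, γ, δ, t, by omega, by omega, h3⟩
  push Not at hbig
  -- the interior indices
  set i0 := E.min' hE with hi0
  set i1 := E.max' hE with hi1
  have hi0E : i0 ∈ E := E.min'_mem hE
  have hi1E : i1 ∈ E := E.max'_mem hE
  set I := (E.erase i0).erase i1 with hIdef
  have hIE : ∀ i ∈ I, i ∈ E := fun i hi => Finset.mem_of_mem_erase (Finset.mem_of_mem_erase hi)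
  have hI0 : ∀ i ∈ I, i0 < i := by
    intro i hi
    have h1 : i ≠ i0 := Finset.ne_of_mem_erase (Finset.mem_of_mem_erase hi)
    have h2 : i0 ≤ i := E.min'_le i (hIE i hi)
    omega
  have hI1 : ∀ i ∈ I, i < i1 := by
    intro i hi
    have h1 : i ≠ i1 := Finset.ne_of_mem_erase hi
    have h2 : i ≤ i1 := E.le_max' i (hIE i hi)
    omega
  have hsumI : 16 * θ ≤ ∑ i ∈ I, peakVar f (p i) (r i) (q i) := by
    have h1 := Finset.add_sum_erase E (fun i => peakVar f (p i) (r i) (q i)) hi0E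
    have h2 := hbig i0 hi0E
    by_cases hc : i1 ∈ E.erase i0
    · have h3 := Finset.add_sum_erase (E.erase i0) (fun i => peakVar f (p i) (r i) (q i)) hc
      have h4 := hbig i1 hi1E
      simp only [← hIdef] at h3
      linarith
    · have : I = E.erase i0 := Finset.erase_eq_of_notMem hc
      rw [this]
      linarith
  have hIne : I.Nonempty := by
    rw [Finset.nonempty_iff_ne_empty]
    intro h
    rw [h] at hsumI
    simp at hsumI
    linarith
  have hpk : ∀ i ∈ E, p i < r i ∧ r i < q i ∧ dM f (p i) < dM f (r i) ∧ dM f (q i) < dM f (r i) :=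
    fun i hi => (hess i hi).1
  have hloc : ∀ i ∈ I, K < p i ∧ q i ≤ K + 2 * l := by
    intro i hi
    have h1 := hord i0 hi0E i (hIE i hi) (hI0 i hi)
    have h2 := hord i (hIE i hi) i1 hi1E (hI1 i hi)
    have h3 := hpk i0 hi0E
    have h4 := hpk i1 hi1E
    have h5 := hr i0 hi0E
    have h6 := hr i1 hi1E
    omega
  have hl' : (0 : ℝ) < l := by exact_mod_cast hl
  -- high points
  have hRt : ∀ i ∈ I, ∀ (z : ℤ) (κ : ℝ), 0 ≤ κ → K < z → z < r i →
      κ * ((r i : ℝ) - z) ≤ dM f (r i) - dM f z →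
      ∃ t, K + 28 * l ≤ t ∧ t ≤ K + 130 * l ∧ dM f (r i) + κ * (30 * l) ≤ f t := by
    intro i hi z κ hκ h1 h2 h3
    have hw' := hw i (hIE i hi)
    have hr' := hr i (hIE i hi)
    obtain ⟨t, ht1, ht2, ht3⟩ := right_point f hf hbv (r i) (w i) (r i - z) (by omega) (by omega)
      (hrad i (hIE i hi)) κ (by rw [show r i - (r i - z) = z by ring]; push_cast; exact h3) hκ
    refine ⟨t, by omega, by omega, le_trans ?_ ht3⟩
    have : 30 * l ≤ w i - (r i - z) := by omega
    have : (30 * l : ℝ) ≤ w i - ((r i - z : ℤ) : ℝ) := by exact_mod_cast this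
    have := mul_le_mul_of_nonneg_left this hκ
    linarith
  have hLt : ∀ i ∈ I, ∀ (z : ℤ) (κ : ℝ), 0 ≤ κ → z ≤ K + 2 * l → r i < z →
      κ * ((z : ℝ) - r i) ≤ dM f (r i) - dM f z →
      ∃ t, K - 128 * l ≤ t ∧ t ≤ K - 26 * l ∧ dM f (r i) + κ * (30 * l) ≤ f t := by
    intro i hi z κ hκ h1 h2 h3
    have hw' := hw i (hIE i hi)
    have hr' := hr i (hIE i hi)
    obtain ⟨t, ht1, ht2, ht3⟩ := left_point f hf hbv (r i) (w i) (z - r i) (by omega) (by omega)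
      (hrad i (hIE i hi)) κ (by rw [show r i + (z - r i) = z by ring]; push_cast; exact h3) hκ
    refine ⟨t, by omega, by omega, le_trans ?_ ht3⟩
    have : 30 * l ≤ w i - (z - r i) := by omega
    have : (30 * l : ℝ) ≤ w i - ((z - r i : ℤ) : ℝ) := by exact_mod_cast this
    have := mul_le_mul_of_nonneg_left this hκ
    linarith
  have hfin : ∀ z s t, K < z → z ≤ K + 2 * l → K - 128 * l ≤ s → s ≤ K - 26 * l →
      K + 28 * l ≤ t → t ≤ K + 130 * l → dM f z + 2 * θ ≤ f s → dM f z + 2 * θ ≤ f t →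
      CoreA f (2 * l) (K - 128 * l) (K + 130 * l) θ ∨
      CoreB f (2 * l) (K - 128 * l) (K + 130 * l) θ := by
    intro z s t h1 h2 h3 h4 h5 h6 h7 h8
    exact core f l _ _ z s t hl θ (dM f z) hθ (by omega) (by omega) h3 h6 h7 h8
      (avg_le_dM f hf hbv z l hl.le)
  have hosc : ∀ i ∈ I, ∀ z, K < z → z ≤ K + 2 * l → dM f z + 2 * θ ≤ dM f (r i) →
      CoreA f (2 * l) (K - 128 * l) (K + 130 * l) θ ∨
      CoreB f (2 * l) (K - 128 * l) (K + 130 * l) θ := by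
    intro i hi z h1 h2 h3
    have h4 := hpk i (hIE i hi)
    have h5 := hloc i hi
    obtain ⟨t, ht1, ht2, ht3⟩ := hRt i hi (p i) 0 le_rfl (by omega) (by omega) (by linarith)
    obtain ⟨s, hs1, hs2, hs3⟩ := hLt i hi (q i) 0 le_rfl (by omega) (by omega) (by linarith)
    exact hfin z s t h1 h2 hs1 hs2 ht1 ht2 (by linarith) (by linarith)
  by_cases ho1 : ∃ i ∈ I, ∃ j ∈ I, dM f (p j) + 2 * θ ≤ dM f (r i)
  · obtain ⟨i, hi, j, hj, h⟩ := ho1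
    have h4 := hpk j (hIE j hj)
    have h5 := hloc j hj
    exact hosc i hi (p j) (by omega) (by omega) h
  by_cases ho2 : ∃ i ∈ I, ∃ j ∈ I, dM f (q j) + 2 * θ ≤ dM f (r i)
  · obtain ⟨i, hi, j, hj, h⟩ := ho2
    have h4 := hpk j (hIE j hj)
    have h5 := hloc j hj
    exact hosc i hi (q j) (by omega) (by omega) h
  push Not at ho1 ho2
  have hκ : 0 ≤ θ / (2 * l : ℝ) := by positivity
  have hκ2 : θ / (2 * l : ℝ) * (30 * l) = 15 * θ := by field_simp; norm_num
  have hsplit : ∑ i ∈ I, peakVar f (p i) (r i) (q i)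
      = ∑ i ∈ I, (dM f (r i) - dM f (p i)) + ∑ i ∈ I, (-dM f (q i) - -dM f (r i)) := by
    rw [← Finset.sum_add_distrib]
    exact Finset.sum_congr rfl fun i _ => by unfold peakVar; ring
  have hlast : ∀ i ∈ I, ∀ j ∈ I, ∀ s t, K - 128 * l ≤ s → s ≤ K - 26 * l →
      K + 28 * l ≤ t → t ≤ K + 130 * l → dM f (r i) + 15 * θ ≤ f s → dM f (r j) + 15 * θ ≤ f t →
      CoreA f (2 * l) (K - 128 * l) (K + 130 * l) θ ∨
      CoreB f (2 * l) (K - 128 * l) (K + 130 * l) θ := by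
    intro i hi j hj s t h1 h2 h3 h4 h5 h6
    have h7 := hpk i (hIE i hi)
    have h8 := hloc i hi
    have h9 := hpk j (hIE j hj)
    have h10 := ho1 i hi j hj
    exact hfin (p i) s t (by omega) (by omega) h1 h2 h3 h4 (by linarith) (by linarith)
  by_cases hU : 8 * θ ≤ ∑ i ∈ I, (dM f (r i) - dM f (p i))
  · obtain ⟨⟨j, hj, h1⟩, ⟨i, hi, i', hi', hii, h2⟩⟩ := steep I (fun i => dM f (r i))
      (fun i => dM f (p i)) (fun i => (p i : ℝ)) (fun i => (r i : ℝ)) (2 * l) θ (by positivity) hθ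
      (fun i hi => by have := (hpk i (hIE i hi)).1; exact_mod_cast this.le) hIne
      (fun i hi j hj hij => by
        have h1 := hord i (hIE i hi) j (hIE j hj) hij
        have h2 := hpk i (hIE i hi)
        have : r i ≤ p j := by omega
        exact_mod_cast this)
      (fun i hi j hj => by
        have h1 := hloc i hi
        have h2 := hr j (hIE j hj)
        have : r j - p i ≤ 2 * l := by omega
        exact_mod_cast this)
      (fun i hi j hj => by have := ho1 j hj i hi; linarith) hU
    have a1 := hpk j (hIE j hj)
    have a2 := hloc j hj
    have a3 := hpk i (hIE i hi)
    have a4 := hloc i' hi'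
    have a5 := hpk i' (hIE i' hi')
    have a6 := hord i (hIE i hi) i' (hIE i' hi') hii
    obtain ⟨t, ht1, ht2, ht3⟩ := hRt j hj (p j) _ hκ (by omega) (by omega) h1
    obtain ⟨s, hs1, hs2, hs3⟩ := hLt i hi (p i') _ hκ (by omega) (by omega) h2
    rw [hκ2] at ht3 hs3
    exact hlast i hi j hj s t hs1 hs2 ht1 ht2 hs3 ht3
  · have hD : 8 * θ ≤ ∑ i ∈ I, (-dM f (q i) - -dM f (r i)) := by linarith
    obtain ⟨⟨j, hj, h1⟩, ⟨i, hi, i', hi', hii, h2⟩⟩ := steep I (fun i => -dM f (q i))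
      (fun i => -dM f (r i)) (fun i => (r i : ℝ)) (fun i => (q i : ℝ)) (2 * l) θ (by positivity) hθ
      (fun i hi => by have := (hpk i (hIE i hi)).2.1; exact_mod_cast this.le) hIne
      (fun i hi j hj hij => by
        have h1 := hord i (hIE i hi) j (hIE j hj) hij
        have h2 := hpk j (hIE j hj)
        have : q i ≤ r j := by omega
        exact_mod_cast this)
      (fun i hi j hj => by
        have h1 := hloc j hj
        have h2 := hr i (hIE i hi)
        have : q j - r i ≤ 2 * l := by omega
        exact_mod_cast this)
      (fun i hi j hj => by have := ho2 i hi j hj; linarith) hD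
    have a1 := hpk j (hIE j hj)
    have a2 := hloc j hj
    have a3 := hpk i (hIE i hi)
    have a4 := hloc i hi
    have a5 := hpk i' (hIE i' hi')
    have a6 := hord i (hIE i hi) i' (hIE i' hi') hii
    obtain ⟨s, hs1, hs2, hs3⟩ := hLt j hj (q j) _ hκ (by omega) (by omega)
      (h1.trans (by linarith))
    obtain ⟨t, ht1, ht2, ht3⟩ := hRt i' hi' (q i) _ hκ (by omega) (by omega)
      (h2.trans (by linarith))
    rw [hκ2] at ht3 hs3
    exact hlast j hj i' hi' s t hs1 hs2 ht1 ht2 hs3 ht3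

/-- Lemma 5 of the paper, if `E^n_k` is nonempty for some `n ≥ 6` and
`k ∈ ℤ`, then alternative A or alternative B holds. -/
theorem stmt10 (f : ℤ → ℝ) (hf : ∀ n, 0 ≤ f n) (hbv : BddVar f)
    (σ : ℕ) (a b : ℕ → ℤ)
    (hab : ∀ i ∈ Finset.Icc 1 σ, a i < b i ∧ b i < a (i + 1))
    (hM : ∀ i ∈ Finset.Icc 1 σ,
      dM f (a i) < dM f (b i) ∧ dM f (a (i + 1)) < dM f (b i))
    (n : ℕ) (hn : 6 ≤ n) (k : ℤ) (hne : (Enk f a b σ n k).Nonempty) :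
    AltA f n k (varEnk f a b σ n k) ∨ AltB f n k (varEnk f a b σ n k) := by
  obtain ⟨m, rfl⟩ : ∃ m, n = m + 6 := ⟨n - 6, by omega⟩
  set l : ℤ := 2 ^ m with hl
  have hlpos : 0 < l := by positivity
  have e1 : (2 : ℤ) ^ (m + 6 - 5) = 2 * l := by
    rw [show m + 6 - 5 = m + 1 by omega, pow_succ]; ring
  have e2 : (2 : ℤ) ^ (m + 6 - 4) = 2 * (2 * l) := by
    rw [show m + 6 - 4 = m + 2 by omega, pow_add]; ring
  have e3 : (2 : ℤ) ^ (m + 6 - 1) = 32 * l := by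
    rw [show m + 6 - 1 = m + 5 by omega, pow_add]; ring
  have e4 : (2 : ℤ) ^ (m + 6) = 64 * l := by
    rw [pow_add]; ring
  have hmem : ∀ i ∈ Enk f a b σ (m + 6) k, i ∈ Finset.Icc 1 σ ∧
      IsEssentialPeak f (a i) (b i) (a (i + 1)) ∧
      ∃ w : ℤ, IsRadius f (b i) w ∧ 2 ^ (m + 6 - 1) < w ∧ w ≤ 2 ^ (m + 6) ∧
      k * 2 ^ (m + 6 - 5) < b i ∧ b i ≤ (k + 1) * 2 ^ (m + 6 - 5) := by
    intro i hi
    unfold Enk at hi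
    exact Finset.mem_filter.mp hi
  simp only [e1, e3, e4] at hmem
  have hex : ∀ i, ∃ w : ℤ, i ∈ Enk f a b σ (m + 6) k → IsRadius f (b i) w ∧ 32 * l < w ∧ w ≤ 64 * l ∧
      k * (2 * l) < b i ∧ b i ≤ (k + 1) * (2 * l) := by
    intro i
    by_cases hi : i ∈ Enk f a b σ (m + 6) k
    · obtain ⟨-, -, w, hw⟩ := hmem i hi
      exact ⟨w, fun _ => hw⟩
    · exact ⟨0, fun h => absurd h hi⟩
  choose w hw using hex
  have hmono : ∀ j i, 1 ≤ i → i ≤ j → j ≤ σ + 1 → a i ≤ a j := by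
    intro j i h1 hij
    induction j, hij using Nat.le_induction with
    | base => intro _; exact le_rfl
    | succ j hj ih =>
      intro h2
      have := hab j (Finset.mem_Icc.mpr ⟨by omega, by omega⟩)
      have := ih (by omega)
      omega
  have hmain := mainCore f hf hbv l (k * (2 * l)) hlpos (Enk f a b σ (m + 6) k) a b
    (fun i => a (i + 1)) w hne (fun i hi => (hmem i hi).2.1) (fun i hi => (hw i hi).1.2.1)
    (fun i hi => ⟨(hw i hi).2.1, (hw i hi).2.2.1⟩)
    (fun i hi => ⟨(hw i hi).2.2.2.1, by have := (hw i hi).2.2.2.2; linarith⟩)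
    (fun i hi j hj hij => by
      have h1 := Finset.mem_Icc.mp (hmem j hj).1
      exact hmono j (i + 1) (by omega) (by omega) (by omega))
    (1 / 24 * varEnk f a b σ (m + 6) k) (by unfold varEnk; ring)
  unfold AltA AltB
  simp only [e1, e2]
  have b1 : (k - 64) * (2 * l) = k * (2 * l) - 128 * l := by ring
  have b2 : (k + 65) * (2 * l) = k * (2 * l) + 130 * l := by ring
  rw [b1, b2]
  rcases hmain with h | h
  · left
    obtain ⟨s, α, β, γ, δ, t, h1, h2, h3, h4, h5, h6, h7, h8⟩ := h
    exact ⟨s, α, β, γ, δ, t, by linarith, by linarith, by linarith, by linarith, by linarith,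
      h1, h2, h3, h4, h5, h6, h7, h8⟩
  · right
    obtain ⟨s, α, β, γ, δ, t, h1, h2, h3, h4, h5, h6, h7, h8⟩ := h
    exact ⟨s, α, β, γ, δ, t, by linarith, by linarith, by linarith, by linarith, by linarith,
      h1, h2, h3, h4, h5, h6, h7, h8⟩

end
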